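/- Let r, p, d ∈ ℕ. For every MSO sentence φ over the vocabulary {E, P_1,…,P_p} of p-labeled graphs, there exists a first-order sentence ψ over the same vocabulary such that for every graph G ∈ TM(r,p,d): G ⊨ φ if and only if G ⊨ ψ. Consequently, the same equivalence holds over any subclass of TM(r,p,d). -/

import Mathlib

open Cardinal

/-- The tower function: `tower 0 n = n`, `tower (d+1) n = 2 ^ tower d n`. -/
def tower : ℕ → ℕ → ℕ
  | 0, n => n
  | d + 1, n => 2 ^ tower d n

/-- MSO formulas over the vocabulary consisting of one binary relation symbol `E`
and unary relation symbols indexed by `ι`.  First-order variables and set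
variables are both indexed by `ℕ`. -/
inductive MSOForm (ι : Type u) : Type u
  | fal : MSOForm ι
  | eq : ℕ → ℕ → MSOForm ι
  | edge : ℕ → ℕ → MSOForm ι
  | pred : ι → ℕ → MSOForm ι
  | mem : ℕ → ℕ → MSOForm ι
  | imp : MSOForm ι → MSOForm ι → MSOForm ι
  | exFO : ℕ → MSOForm ι → MSOForm ι
  | exSO : ℕ → MSOForm ι → MSOForm ι

namespace MSOForm

variable {ι : Type u}

/-- Quantifier rank: the maximum nesting depth of (first- and second-order) quantifiers. -/
def qr : MSOForm ι → ℕ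
  | fal => 0
  | eq _ _ => 0
  | edge _ _ => 0
  | pred _ _ => 0
  | mem _ _ => 0
  | imp φ ψ => max φ.qr ψ.qr
  | exFO _ φ => φ.qr + 1
  | exSO _ φ => φ.qr + 1

/-- Free first-order variables. -/
def freeFO : MSOForm ι → Finset ℕ
  | fal => ∅
  | eq i j => {i, j}
  | edge i j => {i, j}
  | pred _ i => {i}
  | mem i _ => {i}
  | imp φ ψ => φ.freeFO ∪ ψ.freeFO
  | exFO n φ => φ.freeFO.erase n
  | exSO _ φ => φ.freeFO

/-- Free set variables. -/
def freeSO : MSOForm ι → Finset ℕ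
  | fal => ∅
  | eq _ _ => ∅
  | edge _ _ => ∅
  | pred _ _ => ∅
  | mem _ X => {X}
  | imp φ ψ => φ.freeSO ∪ ψ.freeSO
  | exFO _ φ => φ.freeSO
  | exSO X φ => φ.freeSO.erase X

/-- A sentence is a formula with no free variables of either kind. -/
def IsSentence (φ : MSOForm ι) : Prop := φ.freeFO = ∅ ∧ φ.freeSO = ∅

/-- First-order formulas: no set quantification and no set membership. -/
def IsFO : MSOForm ι → Prop
  | fal => True
  | eq _ _ => True
  | edge _ _ => True
  | pred _ _ => True
  | mem _ _ => False
  | imp φ ψ => φ.IsFO ∧ ψ.IsFO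
  | exFO _ φ => φ.IsFO
  | exSO _ _ => False

/-- Formulas that do not mention the binary relation symbol `E`
(i.e. formulas over a purely monadic vocabulary). -/
def NoEdge : MSOForm ι → Prop
  | fal => True
  | eq _ _ => True
  | edge _ _ => False
  | pred _ _ => True
  | mem _ _ => True
  | imp φ ψ => φ.NoEdge ∧ ψ.NoEdge
  | exFO _ φ => φ.NoEdge
  | exSO _ φ => φ.NoEdge

end MSOForm

/-- A structure over the vocabulary with one binary relation `E` and `ι`-indexed
unary predicates: a universe, a binary relation and unary relations. -/
structure MStr (ι : Type u) where
  V : Type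
  E : V → V → Prop
  P : ι → V → Prop

namespace MStr

/-- Satisfaction of an MSO formula under first-order and set variable assignments. -/
def Realize {ι : Type u} (M : MStr ι) : MSOForm ι → (ℕ → M.V) → (ℕ → Set M.V) → Prop
  | .fal, _, _ => False
  | .eq i j, v, _ => v i = v j
  | .edge i j, v, _ => M.E (v i) (v j)
  | .pred a i, v, _ => M.P a (v i)
  | .mem i X, v, s => v i ∈ s X
  | .imp φ ψ, v, s => Realize M φ v s → Realize M ψ v s
  | .exFO n φ, v, s => ∃ x : M.V, Realize M φ (Function.update v n x) s
  | .exSO X φ, v, s => ∃ A : Set M.V, Realize M φ v (Function.update s X A)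

/-- A structure satisfies a sentence. -/
def Sat {ι : Type u} (M : MStr ι) (φ : MSOForm ι) : Prop :=
  ∀ (v : ℕ → M.V) (s : ℕ → Set M.V), M.Realize φ v s

/-- `M ≡^MSO_m N` : `M` and `N` agree on all MSO sentences of quantifier rank at most `m`. -/
def MSOEquiv {ι : Type u} (m : ℕ) (M N : MStr ι) : Prop :=
  ∀ φ : MSOForm ι, φ.IsSentence → φ.qr ≤ m → (M.Sat φ ↔ N.Sat φ)

/-- `M` and `N` agree on all MSO sentences. -/
def MSOEq {ι : Type u} (M N : MStr ι) : Prop :=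
  ∀ φ : MSOForm ι, φ.IsSentence → (M.Sat φ ↔ N.Sat φ)

/-- `M ≡^FO_q N` over a purely monadic vocabulary: `M` and `N` agree on all
first-order sentences (not mentioning `E`) of quantifier rank at most `q`. -/
def FOEquiv {ι : Type u} (q : ℕ) (M N : MStr ι) : Prop :=
  ∀ φ : MSOForm ι, φ.IsFO → φ.NoEdge → φ.IsSentence → φ.qr ≤ q → (M.Sat φ ↔ N.Sat φ)

end MStr

/-- A (finite or infinite) `p`-labeled graph: a simple undirected loop-free graph
each of whose vertices carries exactly one label from `Fin p`. -/
structure PGraph (p : ℕ) where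
  V : Type
  adj : V → V → Prop
  symm : ∀ u v, adj u v → adj v u
  irrefl : ∀ v, ¬ adj v v
  label : V → Fin p

namespace PGraph

variable {p : ℕ}

/-- A `p`-labeled graph as a structure over the vocabulary `{E, P_1, …, P_p}`. -/
def toStr (G : PGraph p) : MStr (Fin p) :=
  ⟨G.V, G.adj, fun j v => G.label v = j⟩

/-- The induced labeled subgraph on a set of vertices (with the inherited labels). -/
def induce (G : PGraph p) (s : Set G.V) : PGraph p where
  V := ↥s
  adj a b := G.adj a.1 b.1
  symm := fun _ _ h => G.symm _ _ h
  irrefl := fun _ h => G.irrefl _ h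
  label := fun a => G.label a.1

/-- `G` is an induced labeled subgraph of `H` (up to isomorphism):
there is an injection of `G` into `H` preserving adjacency, non-adjacency and labels. -/
def Emb (G H : PGraph p) : Prop :=
  ∃ f : G.V → H.V, Function.Injective f ∧
    (∀ a b, G.adj a b ↔ H.adj (f a) (f b)) ∧ ∀ a, H.label (f a) = G.label a

end PGraph

/-- A tree model with `r` labels and height `d` for a `p`-labeled graph `G`:
a rooted tree all of whose root-to-leaf paths have length exactly `d`, whose
leaves are exactly the vertices of `G`, each leaf carrying a pair `(i, j)` with
`i ∈ Fin r` (recorded by `iLab`) and `j` the label of the vertex in `G`,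
together with a symmetric signature `S` determining adjacency from the leaf
labels and the distance in the tree. -/
structure TModel (r p d : ℕ) (G : PGraph p) where
  W : Type
  g : SimpleGraph W
  tree : g.IsTree
  root : W
  depthLe : ∀ w, g.dist root w ≤ d
  branch : ∀ w, g.dist root w < d → ∃ w', g.Adj w w' ∧ g.dist root w' = g.dist root w + 1
  leafEquiv : G.V ≃ {w : W // g.dist root w = d}
  iLab : G.V → Fin r
  S : Set (Fin r × Fin r × ℕ)
  S_range : ∀ x ∈ S, 1 ≤ x.2.2 ∧ x.2.2 ≤ d
  S_symm : ∀ i j l, (i, j, l) ∈ S ↔ (j, i, l) ∈ S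
  edge_iff : ∀ u v : G.V, u ≠ v → ∀ l : ℕ,
    g.dist (leafEquiv u).1 (leafEquiv v).1 = 2 * l →
      (G.adj u v ↔ (iLab u, iLab v, l) ∈ S)

/-- The class of all (finite or infinite) `p`-labeled graphs admitting a tree model
with `r` labels and height `d`. -/
def TM (r p d : ℕ) : Set (PGraph p) := {G | Nonempty (TModel r p d G)}

universe u

namespace MSOForm

variable {ι : Type u}

/-- A property of structures with an assignment is `FODef n` when it is expressed by a first-order
formula whose free variables are among the first `n` ones. -/
def FODef (n : ℕ) (Q : ∀ M : MStr ι, (ℕ → M.V) → Prop) : Prop :=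
  ∃ ψ : MSOForm ι, ψ.IsFO ∧ ψ.freeFO ⊆ Finset.range n ∧ ψ.freeSO = ∅ ∧
    ∀ (M : MStr ι) (v : ℕ → M.V) (s : ℕ → Set M.V), M.Realize ψ v s ↔ Q M v

namespace FODef

variable {n : ℕ} {Q Q' : ∀ M : MStr ι, (ℕ → M.V) → Prop}

lemma congr (h : FODef n Q) (hQ : ∀ M v, Q M v ↔ Q' M v) : FODef n Q' := by
  obtain ⟨ψ, h1, h2, h3, h4⟩ := h
  exact ⟨ψ, h1, h2, h3, fun M v s => (h4 M v s).trans (hQ M v)⟩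

lemma fal : FODef (ι := ι) n (fun _ _ => False) :=
  ⟨.fal, trivial, by simp [freeFO], rfl, fun _ _ _ => Iff.rfl⟩

lemma eq {i j : ℕ} (hi : i < n) (hj : j < n) :
    FODef (ι := ι) n (fun _ v => v i = v j) :=
  ⟨.eq i j, trivial, by simp [freeFO, Finset.insert_subset_iff, hi, hj], rfl, fun _ _ _ => Iff.rfl⟩

lemma edge {i j : ℕ} (hi : i < n) (hj : j < n) :
    FODef n (fun (M : MStr ι) v => M.E (v i) (v j)) :=
  ⟨.edge i j, trivial, by simp [freeFO, Finset.insert_subset_iff, hi, hj], rfl,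
    fun _ _ _ => Iff.rfl⟩

lemma pred (a : ι) {i : ℕ} (hi : i < n) : FODef n (fun (M : MStr ι) v => M.P a (v i)) :=
  ⟨.pred a i, trivial, by simp [freeFO, hi], rfl, fun _ _ _ => Iff.rfl⟩

lemma imp (h : FODef n Q) (h' : FODef n Q') : FODef n (fun M v => Q M v → Q' M v) := by
  obtain ⟨ψ, h1, h2, h3, h4⟩ := h
  obtain ⟨ψ', h1', h2', h3', h4'⟩ := h'
  refine ⟨.imp ψ ψ', ⟨h1, h1'⟩, Finset.union_subset h2 h2', by simp [freeSO, h3, h3'], ?_⟩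
  intro M v s
  exact imp_congr (h4 M v s) (h4' M v s)

lemma not (h : FODef n Q) : FODef n (fun M v => ¬ Q M v) := h.imp fal

lemma and (h : FODef n Q) (h' : FODef n Q') : FODef n (fun M v => Q M v ∧ Q' M v) :=
  (h.imp h'.not).not.congr fun M v => by tauto

lemma iff (h : FODef n Q) (h' : FODef n Q') : FODef n (fun M v => Q M v ↔ Q' M v) :=
  ((h.imp h').and (h'.imp h)).congr fun M v => by tauto

lemma const (a : Prop) : FODef (ι := ι) n (fun _ _ => a) := by
  by_cases ha : a
  · exact fal.not.congr fun M v => by simp [ha]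
  · exact fal.congr fun M v => by simp [ha]

lemma all {α : Type*} [Finite α] {R : α → ∀ M : MStr ι, (ℕ → M.V) → Prop}
    (h : ∀ i, FODef n (R i)) : FODef n (fun M v => ∀ i, R i M v) := by
  classical
  have := Fintype.ofFinite α
  have key : ∀ s : Finset α, FODef n (fun M v => ∀ i ∈ s, R i M v) := by
    intro s
    induction s using Finset.induction_on with
    | empty => exact (const True).congr fun M v => by simp
    | insert a s _ ih => exact ((h a).and ih).congr fun M v => by simp
  exact (key Finset.univ).congr fun M v => by simp

lemma ex (h : FODef (n + 1) Q) :
    FODef n (fun M v => ∃ x, Q M (Function.update v n x)) := by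
  obtain ⟨ψ, h1, h2, h3, h4⟩ := h
  refine ⟨.exFO n ψ, h1, ?_, h3, ?_⟩
  · intro i hi
    have hi' : i ≠ n ∧ i ∈ ψ.freeFO := by simpa [freeFO] using hi
    have := Finset.mem_range.1 (h2 hi'.2)
    have := hi'.1
    exact Finset.mem_range.2 (by omega)
  · intro M v s
    exact exists_congr fun x => h4 M _ s

end FODef

end MSOForm

/-- First-order types of quantifier rank `q` of an `n`-tuple. -/
def FOType (ι : Type u) : ℕ → ℕ → Type u
  | 0, n => (Fin n → Fin n → Prop) × (Fin n → Fin n → Prop) × (ι → Fin n → Prop)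
  | q + 1, n => Set (FOType ι q (n + 1))

lemma FOType.finite (ι : Type u) [Finite ι] : ∀ q n, Finite (FOType ι q n)
  | 0, n => by unfold FOType; infer_instance
  | q + 1, n => by
    have := FOType.finite ι q (n + 1)
    unfold FOType; infer_instance

namespace MStr

variable {ι : Type u}

/-- The first-order type of quantifier rank `q` of the first `n` entries of `v`. -/
def foType (M : MStr ι) : ∀ q n : ℕ, (ℕ → M.V) → FOType ι q n
  | 0, _, v => (fun i j => v i = v j, fun i j => M.E (v i) (v j), fun a i => M.P a (v i))
  | q + 1, n, v => {τ : FOType ι q (n + 1) | ∃ x, M.foType q (n + 1) (Function.update v n x) = τ}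

lemma foDef_foType [Finite ι] (q n : ℕ) (τ : FOType ι q n) :
    MSOForm.FODef n (fun (M : MStr ι) v => M.foType q n v = τ) := by
  induction q generalizing n with
  | zero =>
    obtain ⟨A, B, P⟩ := τ
    have hA : MSOForm.FODef n (fun (M : MStr ι) v => ∀ i j : Fin n, (v i = v j) ↔ A i j) :=
      .all fun i => .all fun j => (MSOForm.FODef.eq i.2 j.2).iff (.const _)
    have hB : MSOForm.FODef n (fun (M : MStr ι) v => ∀ i j : Fin n, M.E (v i) (v j) ↔ B i j) :=
      .all fun i => .all fun j => (MSOForm.FODef.edge i.2 j.2).iff (.const _)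
    have hP : MSOForm.FODef n
        (fun (M : MStr ι) v => ∀ (a : ι) (i : Fin n), M.P a (v i) ↔ P a i) :=
      .all fun a => .all fun i => (MSOForm.FODef.pred a i.2).iff (.const _)
    refine (hA.and (hB.and hP)).congr fun M v => ?_
    simp only [foType]
    erw [Prod.mk.injEq, Prod.mk.injEq]
    simp only [funext_iff, eq_iff_iff]
  | succ q ih =>
    have := FOType.finite ι q (n + 1)
    have h : MSOForm.FODef n (fun (M : MStr ι) v => ∀ σ : FOType ι q (n + 1),
        (∃ x, M.foType q (n + 1) (Function.update v n x) = σ) ↔ (show Set _ from τ) σ) :=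
      .all fun σ => (ih (n + 1) σ).ex.iff (.const _)
    refine h.congr fun M v => ?_
    exact (Set.ext_iff (a := {σ : FOType ι q (n + 1) |
      ∃ x, M.foType q (n + 1) (Function.update v n x) = σ}) (b := τ)).symm

/-- A play of the Ehrenfeucht-Fraïssé game of length `Q` that answers requests for values
of the unary functions `f o` and `g o`. -/
lemma exists_play {M N : MStr ι} {O : Type*} (f : O → M.V → M.V) (g : O → N.V → N.V)
    (req : ℕ → ℕ × (O ⊕ O)) (Q : ℕ) {v : ℕ → M.V} {w : ℕ → N.V}
    (h : M.foType Q 0 v = N.foType Q 0 w) :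
    ∃ (a : ℕ → M.V) (b : ℕ → N.V), M.foType 0 Q a = N.foType 0 Q b ∧
      ∀ m < Q, ∀ k < m, ∀ o, (req m = (k, .inl o) → a m = f o (a k)) ∧
        (req m = (k, .inr o) → b m = g o (b k)) := by
  have key : ∀ n q, n + q = Q → ∃ (a : ℕ → M.V) (b : ℕ → N.V), M.foType q n a = N.foType q n b ∧
      ∀ m < n, ∀ k < m, ∀ o, (req m = (k, .inl o) → a m = f o (a k)) ∧
        (req m = (k, .inr o) → b m = g o (b k)) := by
    intro n
    induction n with
    | zero =>
      rintro q hq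
      obtain rfl : q = Q := by omega
      exact ⟨v, w, h, by simp⟩
    | succ n ih =>
      intro q hq
      obtain ⟨a, b, hab, hr⟩ := ih (q + 1) (by omega)
      have forth : ∀ x, ∃ y, M.foType q (n + 1) (Function.update a n x) =
          N.foType q (n + 1) (Function.update b n y) := by
        intro x
        have : M.foType q (n + 1) (Function.update a n x) ∈
            (show Set (FOType ι q (n + 1)) from M.foType (q + 1) n a) := ⟨x, rfl⟩
        rw [hab] at this
        obtain ⟨y, hy⟩ := this
        exact ⟨y, hy.symm⟩
      have back : ∀ y, ∃ x, M.foType q (n + 1) (Function.update a n x) =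
          N.foType q (n + 1) (Function.update b n y) := by
        intro y
        have : N.foType q (n + 1) (Function.update b n y) ∈
            (show Set (FOType ι q (n + 1)) from N.foType (q + 1) n b) := ⟨y, rfl⟩
        rw [← hab] at this
        exact this
      have step : ∃ x y, M.foType q (n + 1) (Function.update a n x) =
          N.foType q (n + 1) (Function.update b n y) ∧
          ∀ k < n, ∀ o, (req n = (k, .inl o) → x = f o (a k)) ∧
            (req n = (k, .inr o) → y = g o (b k)) := by
        rcases hreq : req n with ⟨k, o | o⟩
        · obtain ⟨y, hy⟩ := forth (f o (a k))
          refine ⟨_, y, hy, fun k' _ o' => ⟨?_, by simp⟩⟩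
          rintro ⟨⟩
          rfl
        · obtain ⟨x, hx⟩ := back (g o (b k))
          refine ⟨x, _, hx, fun k' _ o' => ⟨by simp, ?_⟩⟩
          rintro ⟨⟩
          rfl
      obtain ⟨x, y, hxy, hxyr⟩ := step
      refine ⟨_, _, hxy, fun m hm k hk o => ?_⟩
      have hkn : k ≠ n := by omega
      rcases eq_or_ne m n with rfl | hmn
      · simpa [hkn] using hxyr k hk o
      · simpa [hkn, hmn] using hr m (by omega) k hk o
  exact key Q 0 rfl

end MStr

lemma exists_requests (X : Type*) [Countable X] [Nonempty X] :
    ∃ req : ℕ → ℕ × X, ∀ n x, ∃ m, n < m ∧ req m = (n, x) := by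
  obtain ⟨g, hg⟩ := exists_surjective_nat ((ℕ × X) × ℕ)
  refine ⟨fun m => (g m).1, fun n x => ?_⟩
  have : (Set.univ : Set ℕ) ⊆ (fun m => (g m).2) '' {m | (g m).1 = (n, x)} := by
    intro j _
    obtain ⟨m, hm⟩ := hg ((n, x), j)
    exact ⟨m, by simp [hm], by simp [hm]⟩
  have hinf : {m | (g m).1 = (n, x)}.Infinite :=
    (Set.infinite_univ.mono this).of_image _
  obtain ⟨m, hm, hnm⟩ := hinf.exists_gt n
  exact ⟨m, hnm, hm⟩

/-- Two sets have the same cardinality up to the threshold `t`. -/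
def SameCardUpTo {α β : Type*} (t : ℕ) (A : Set α) (B : Set β) : Prop :=
  ∀ k : ℕ, k ≤ t → ((k : ℕ∞) ≤ A.encard ↔ (k : ℕ∞) ≤ B.encard)

namespace SameCardUpTo

variable {α β : Type*} {t : ℕ} {A A' : Set α} {B B' : Set β}

lemma encard_eq_or (h : SameCardUpTo t A B) :
    A.encard = B.encard ∨ ((t : ℕ∞) ≤ A.encard ∧ (t : ℕ∞) ≤ B.encard) := by
  by_cases ht : (t : ℕ∞) ≤ A.encard
  · exact .inr ⟨ht, (h t le_rfl).1 ht⟩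
  · have hB : ¬ (t : ℕ∞) ≤ B.encard := fun hB => ht ((h t le_rfl).2 hB)
    push Not at ht hB
    left
    obtain ⟨a, ha⟩ := ENat.ne_top_iff_exists.1 ht.ne_top
    obtain ⟨b, hb⟩ := ENat.ne_top_iff_exists.1 hB.ne_top
    have ha' : a < t := by exact_mod_cast ha ▸ ht
    have hb' : b < t := by exact_mod_cast hb ▸ hB
    have h1 := (h a ha'.le).1 ha.le
    have h2 := (h b hb'.le).2 hb.le
    exact le_antisymm (ha ▸ h1) (hb ▸ h2)

lemma of_encard_eq (h : A.encard = B.encard) : SameCardUpTo t A B := fun k _ => by rw [h]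

lemma of_le (hA : (t : ℕ∞) ≤ A.encard) (hB : (t : ℕ∞) ≤ B.encard) : SameCardUpTo t A B := by
  intro k hk
  have : (k : ℕ∞) ≤ t := by exact_mod_cast hk
  exact ⟨fun _ => this.trans hB, fun _ => this.trans hA⟩

lemma union (h : SameCardUpTo t A B) (h' : SameCardUpTo t A' B') (hA : Disjoint A A')
    (hB : Disjoint B B') : SameCardUpTo t (A ∪ A') (B ∪ B') := by
  rcases h.encard_eq_or with h1 | ⟨h1, h2⟩
  · rcases h'.encard_eq_or with h1' | ⟨h1', h2'⟩
    · apply of_encard_eq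
      rw [Set.encard_union_eq hA, Set.encard_union_eq hB, h1, h1']
    · exact of_le (h1'.trans (Set.encard_le_encard Set.subset_union_right))
        (h2'.trans (Set.encard_le_encard Set.subset_union_right))
  · exact of_le (h1.trans (Set.encard_le_encard Set.subset_union_left))
      (h2.trans (Set.encard_le_encard Set.subset_union_left))

lemma of_fibers {S : Type*} [Finite S] (f : α → S) (g : β → S)
    (h : ∀ s, SameCardUpTo t {x ∈ A | f x = s} {y ∈ B | g y = s}) : SameCardUpTo t A B := by
  classical
  have := Fintype.ofFinite S
  have key : ∀ F : Finset S, SameCardUpTo t {x ∈ A | f x ∈ F} {y ∈ B | g y ∈ F} := by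
    intro F
    induction F using Finset.induction_on with
    | empty => exact of_encard_eq (by simp)
    | insert s F hs ih =>
      have hA : {x ∈ A | f x ∈ insert s F} = {x ∈ A | f x = s} ∪ {x ∈ A | f x ∈ F} := by
        ext x; simp only [Finset.mem_insert, Set.mem_ofPred_eq, Set.mem_union]; tauto
      have hB : {x ∈ B | g x ∈ insert s F} = {x ∈ B | g x = s} ∪ {x ∈ B | g x ∈ F} := by
        ext x; simp only [Finset.mem_insert, Set.mem_ofPred_eq, Set.mem_union]; tauto
      rw [hA, hB]
      refine (h s).union ih ?_ ?_
      · rw [Set.disjoint_left]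
        rintro x ⟨-, rfl⟩ ⟨-, hx⟩
        exact hs hx
      · rw [Set.disjoint_left]
        rintro x ⟨-, rfl⟩ ⟨-, hx⟩
        exact hs hx
  simpa using key Finset.univ

/-- A finite colouring of `A` can be copied to `B` when their cardinalities agree up to a large
threshold. -/
lemma exists_coloring [Nonempty α] [Nonempty β] {S : Type*} [Finite S] {t' : ℕ} (ht : t' * Nat.card S < t)
    (h : SameCardUpTo t A B) (f : α → S) :
    ∃ g : β → S, ∀ s, SameCardUpTo t' {x ∈ A | f x = s} {y ∈ B | g y = s} := by
  classical
  have := Fintype.ofFinite S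
  by_cases htA : (t : ℕ∞) ≤ A.encard
  · have htB := (h t le_rfl).1 htA
    -- a colour class with at least `t'` elements
    have hs₀ : ∃ s₀, (t' : ℕ∞) ≤ {x ∈ A | f x = s₀}.encard := by
      obtain ⟨A₀, hA₀, hcard⟩ := Set.exists_subset_encard_eq htA
      have hfin : A₀.Finite := Set.finite_of_encard_eq_coe hcard
      have hc : hfin.toFinset.card = t := by
        have := hfin.encard_eq_coe_toFinset_card
        rw [hcard] at this
        exact_mod_cast this.symm
      obtain ⟨s₀, -, hs₀⟩ := Finset.exists_lt_card_fiber_of_mul_lt_card_of_maps_to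
        (s := hfin.toFinset) (t := Finset.univ) (f := f) (n := t') (by simp)
        (by rw [hc, Finset.card_univ, ← Nat.card_eq_fintype_card, mul_comm]; exact ht)
      refine ⟨s₀, ?_⟩
      have hsub : ((hfin.toFinset.filter (fun x => f x = s₀) : Finset α) : Set α) ⊆
          {x ∈ A | f x = s₀} := by
        intro x hx
        simp only [Finset.coe_filter, Set.Finite.mem_toFinset, Set.mem_ofPred_eq] at hx
        exact ⟨hA₀ hx.1, hx.2⟩
      refine le_trans ?_ (Set.encard_le_encard hsub)
      rw [Set.encard_coe_eq_coe_finsetCard]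
      exact_mod_cast hs₀.le
    obtain ⟨s₀, hs₀⟩ := hs₀
    have hJ : ∀ s, ∃ J ⊆ {x ∈ A | f x = s}, J.encard = min (t' : ℕ∞) {x ∈ A | f x = s}.encard :=
      fun s => Set.exists_subset_encard_eq (min_le_right _ _)
    choose J hJsub hJcard using hJ
    have hU : (⋃ s, J s).encard ≤ B.encard := by
      have h1 : (⋃ s, J s).encard ≤ ∑ s, (J s).encard := by
        simpa using Finset.univ.set_encard_biUnion_le J
      refine h1.trans ?_
      have h2 : ∑ s, (J s).encard ≤ ∑ _s : S, (t' : ℕ∞) :=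
        Finset.sum_le_sum fun s _ => by rw [hJcard]; exact min_le_left _ _
      refine h2.trans (le_trans ?_ htB)
      rw [Finset.sum_const, Finset.card_univ, ← Nat.card_eq_fintype_card, nsmul_eq_mul, mul_comm]
      exact_mod_cast ht.le
    have hUfin : (⋃ s, J s).Finite := Set.finite_iUnion fun s => by
      apply Set.finite_of_encard_le_coe (k := t')
      rw [hJcard]; exact min_le_left _ _
    obtain ⟨e, heB, hinj⟩ := hUfin.exists_injOn_of_encard_le hU
    have hJmem : ∀ {s x}, x ∈ J s → x ∈ ⋃ s, J s := fun {s x} hx => Set.mem_iUnion.2 ⟨s, hx⟩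
    let g : β → S := fun y => if hy : ∃ x ∈ ⋃ s, J s, e x = y then f hy.choose else s₀
    have hge : ∀ x ∈ ⋃ s, J s, g (e x) = f x := by
      intro x hx
      have hy : ∃ x' ∈ ⋃ s, J s, e x' = e x := ⟨x, hx, rfl⟩
      have : hy.choose = x := hinj hy.choose_spec.1 hx hy.choose_spec.2
      simp only [g, dif_pos hy, this]
    have himg : ∀ s, e '' J s ⊆ {y ∈ B | g y = s} := by
      rintro s _ ⟨x, hx, rfl⟩
      refine ⟨heB (hJmem hx), ?_⟩
      rw [hge x (hJmem hx)]
      exact (hJsub s hx).2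
    have hcard_img : ∀ s, (e '' J s).encard = (J s).encard := fun s =>
      (hinj.mono fun x hx => hJmem hx).encard_image
    refine ⟨g, fun s => ?_⟩
    rcases eq_or_ne s s₀ with rfl | hne
    · refine of_le hs₀ (le_trans ?_ (Set.encard_le_encard (himg s)))
      rw [hcard_img, hJcard, min_eq_left hs₀]
    · have himg' : {y ∈ B | g y = s} = e '' J s := by
        refine Set.Subset.antisymm ?_ (himg s)
        rintro y ⟨-, hy⟩
        by_cases hex : ∃ x ∈ ⋃ s, J s, e x = y
        · obtain ⟨x, hx, rfl⟩ := hex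
          rw [hge x hx] at hy
          obtain ⟨s', hs'⟩ := Set.mem_iUnion.1 hx
          have := (hJsub s' hs').2
          obtain rfl : s' = s := this.symm.trans hy
          exact ⟨x, hs', rfl⟩
        · simp only [g, dif_neg hex] at hy
          exact absurd hy.symm hne
      intro k hk
      have hk' : (k : ℕ∞) ≤ t' := by exact_mod_cast hk
      rw [himg', hcard_img, hJcard, le_min_iff]
      exact ⟨fun h => ⟨hk', h⟩, fun h => h.2⟩
  · have heq : A.encard = B.encard := h.encard_eq_or.resolve_right fun h => htA h.1
    have hBt : B.encard < t := heq ▸ not_le.1 htA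
    have hBfin : B.Finite := Set.finite_of_encard_le_coe hBt.le
    obtain ⟨e, he⟩ := hBfin.exists_bijOn_of_encard_eq heq.symm
    refine ⟨f ∘ e, fun s => of_encard_eq ?_⟩
    have himg : e '' {y ∈ B | (f ∘ e) y = s} = {x ∈ A | f x = s} := by
      ext x
      constructor
      · rintro ⟨y, ⟨hy, hys⟩, rfl⟩
        exact ⟨he.mapsTo hy, hys⟩
      · rintro ⟨hx, hxs⟩
        obtain ⟨y, hy, rfl⟩ := he.surjOn hx
        exact ⟨y, ⟨hy, hxs⟩, rfl⟩
    rw [← himg]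
    exact (he.injOn.mono fun y hy => hy.1).encard_image

end SameCardUpTo

/-- A space with an ultrametric taking values in `{0, …, d}`; equivalently, the set of leaves of a
tree all of whose branches have length `d`. -/
structure LevelSpace (d : ℕ) where
  V : Type
  lev : V → V → ℕ
  lev_le : ∀ x y, lev x y ≤ d
  lev_eq_zero : ∀ x y, lev x y = 0 ↔ x = y
  lev_comm : ∀ x y, lev x y = lev y x
  lev_tri : ∀ x y z, lev x z ≤ max (lev x y) (lev y z)

/-- Types of balls of radius `l` in a `C`-coloured level space, counting up to `t`. -/
def BallType (C : Type) (t : ℕ) : ℕ → Type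
  | 0 => C
  | l + 1 => Set (BallType C t l × Fin (t + 1))

lemma BallType.finite (C : Type) [Finite C] (t : ℕ) : ∀ l, Finite (BallType C t l)
  | 0 => by unfold BallType; infer_instance
  | l + 1 => by
    have := BallType.finite C t l
    unfold BallType; infer_instance

namespace LevelSpace

variable {d : ℕ} {C D : Type}

lemma lev_self (X : LevelSpace d) (x : X.V) : X.lev x x = 0 := (X.lev_eq_zero x x).2 rfl

lemma lev_le_of_le (X : LevelSpace d) {x y z : X.V} {l : ℕ} (h : X.lev x y ≤ l)
    (h' : X.lev y z ≤ l) : X.lev x z ≤ l := (X.lev_tri x y z).trans (max_le h h')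

/-- `f` picks points from different balls of radius `l` inside the ball of radius `l + 1`
around `x`. -/
def IsPacking (X : LevelSpace d) (l : ℕ) (x : X.V) {k : ℕ} (f : Fin k → X.V) : Prop :=
  (∀ i, X.lev x (f i) ≤ l + 1) ∧ ∀ i j, i ≠ j → l < X.lev (f i) (f j)

/-- The type of the ball of radius `l` around a point. -/
def ballType (X : LevelSpace d) (c : X.V → C) (t : ℕ) : ∀ l, X.V → BallType C t l
  | 0, x => c x
  | l + 1, x => {p : BallType C t l × Fin (t + 1) | ∃ f : Fin p.2 → X.V,
      X.IsPacking l x f ∧ ∀ i, X.ballType c t l (f i) = p.1}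

lemma ballType_eq_of_lev_le (X : LevelSpace d) (c : X.V → C) (t l : ℕ) {x y : X.V}
    (h : X.lev x y ≤ l) : X.ballType c t l x = X.ballType c t l y := by
  cases l with
  | zero => rw [(X.lev_eq_zero x y).1 (Nat.le_zero.1 h)]
  | succ l =>
    refine Set.ext fun p => exists_congr fun f => and_congr_left fun _ => and_congr_left fun _ =>
      forall_congr' fun i => ⟨fun hi => X.lev_le_of_le (X.lev_comm x y ▸ h) hi,
        fun hi => X.lev_le_of_le h hi⟩

lemma ballType_congr (X : LevelSpace d) {c c' : X.V → C} (t l : ℕ) {x : X.V}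
    (h : ∀ z, X.lev x z ≤ l → c z = c' z) : X.ballType c t l x = X.ballType c' t l x := by
  induction l generalizing x with
  | zero => exact h x (X.lev_self x).le
  | succ l ih =>
    refine Set.ext fun p => exists_congr fun f => and_congr_right fun hf => forall_congr' fun i => ?_
    rw [ih fun z hz => h z (X.lev_le_of_le (hf.1 i) (hz.trans (Nat.le_succ l)))]

lemma exists_rep (X : LevelSpace d) (l : ℕ) : ∃ ρ : X.V → X.V, (∀ y, X.lev y (ρ y) ≤ l) ∧
    ∀ y z, X.lev y z ≤ l → ρ y = ρ z := by
  let S : Setoid X.V := ⟨fun y z => X.lev y z ≤ l, fun y => by simp [X.lev_self],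
    fun {y z} h => X.lev_comm y z ▸ h, fun h h' => X.lev_le_of_le h h'⟩
  refine ⟨fun y => (Quotient.mk S y).out, fun y => ?_, fun y z h => ?_⟩
  · exact S.symm (Quotient.mk_out (s := S) y)
  · exact congrArg Quotient.out (Quotient.sound (s := S) h)

lemma mem_ballType_succ (X : LevelSpace d) (c : X.V → C) (t l : ℕ) {ρ : X.V → X.V}
    (hρ : ∀ y, X.lev y (ρ y) ≤ l) (hρ' : ∀ y z, X.lev y z ≤ l → ρ y = ρ z) (x : X.V)
    (τ : BallType C t l) (k : Fin (t + 1)) :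
    (∃ f : Fin k → X.V, X.IsPacking l x f ∧ ∀ i, X.ballType c t l (f i) = τ) ↔
      ((k : ℕ) : ℕ∞) ≤ {y | (ρ y = y ∧ X.lev x y ≤ l + 1) ∧ X.ballType c t l y = τ}.encard := by
  constructor
  · rintro ⟨f, hf, hτ⟩
    have hinj : Function.Injective (ρ ∘ f) := by
      intro i j hij
      by_contra hne
      have h1 : X.lev (f i) (f j) ≤ l :=
        X.lev_le_of_le (hρ (f i)) (by rw [X.lev_comm]; exact (show ρ (f i) = ρ (f j) from hij) ▸ hρ (f j))
      exact absurd (hf.2 i j hne) (by omega)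
    have hsub : Set.range (ρ ∘ f) ⊆
        {y | (ρ y = y ∧ X.lev x y ≤ l + 1) ∧ X.ballType c t l y = τ} := by
      rintro _ ⟨i, rfl⟩
      refine ⟨⟨(hρ' _ _ (hρ (f i))).symm,
        X.lev_le_of_le (hf.1 i) ((hρ (f i)).trans (Nat.le_succ l))⟩, ?_⟩
      rw [← hτ i]
      exact (X.ballType_eq_of_lev_le c t l (hρ (f i))).symm
    refine le_trans ?_ (Set.encard_le_encard hsub)
    rw [← Set.image_univ, hinj.encard_image, Set.encard_univ]
    simp
  · intro h
    obtain ⟨A, hA, hcard⟩ := Set.exists_subset_encard_eq h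
    have hfin : A.Finite := Set.finite_of_encard_eq_coe hcard
    have hc : hfin.toFinset.card = k := by
      have := hfin.encard_eq_coe_toFinset_card
      rw [hcard] at this
      exact_mod_cast this.symm
    let e := (hfin.toFinset.equivFinOfCardEq hc).symm
    have he : ∀ i, (e i : X.V) ∈ A := fun i => hfin.mem_toFinset.1 (e i).2
    refine ⟨fun i => e i, ⟨fun i => (hA (he i)).1.2, fun i j hij => ?_⟩, fun i => (hA (he i)).2⟩
    by_contra hlt
    have h1 := hρ' _ _ (not_lt.1 hlt)
    rw [(hA (he i)).1.1, (hA (he j)).1.1] at h1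
    exact hij (e.injective (Subtype.ext h1))

lemma ballType_succ_eq_iff (X Y : LevelSpace d) (c : X.V → C) (c' : Y.V → C) (t l : ℕ)
    {ρ : X.V → X.V} (hρ : ∀ y, X.lev y (ρ y) ≤ l) (hρ' : ∀ y z, X.lev y z ≤ l → ρ y = ρ z)
    {π : Y.V → Y.V} (hπ : ∀ y, Y.lev y (π y) ≤ l) (hπ' : ∀ y z, Y.lev y z ≤ l → π y = π z)
    (x : X.V) (y : Y.V) :
    X.ballType c t (l + 1) x = Y.ballType c' t (l + 1) y ↔ ∀ τ, SameCardUpTo t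
      {z | (ρ z = z ∧ X.lev x z ≤ l + 1) ∧ X.ballType c t l z = τ}
      {z | (π z = z ∧ Y.lev y z ≤ l + 1) ∧ Y.ballType c' t l z = τ} := by
  constructor
  · intro h τ k hk
    have := Set.ext_iff.1 h (τ, ⟨k, by omega⟩)
    exact (X.mem_ballType_succ c t l hρ hρ' x τ ⟨k, by omega⟩).symm.trans
      (this.trans (Y.mem_ballType_succ c' t l hπ hπ' y τ ⟨k, by omega⟩))
  · intro h
    refine Set.ext fun ⟨τ, k⟩ => ?_
    exact (X.mem_ballType_succ c t l hρ hρ' x τ k).trans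
      ((h τ k (by omega)).trans (Y.mem_ballType_succ c' t l hπ hπ' y τ k).symm)

/-- Balls of equal type admit the same refinements of their colourings. -/
lemma exists_refinement [Finite C] [Finite D] (R : C → D → Prop) {t' : ℕ} (ht' : 1 ≤ t') (l : ℕ) :
    ∃ t₀, ∀ t, t₀ ≤ t → ∀ (X Y : LevelSpace d) (c : X.V → C) (c' : Y.V → C) (x : X.V) (y : Y.V),
      X.ballType c t l x = Y.ballType c' t l y → ∀ e : X.V → D, (∀ z, R (c z) (e z)) →
        ∃ e' : Y.V → D, (∀ z, Y.lev y z ≤ l → R (c' z) (e' z)) ∧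
          X.ballType e t' l x = Y.ballType e' t' l y := by
  induction l with
  | zero =>
    refine ⟨0, fun t _ X Y c c' x y h e he => ⟨fun _ => e x, fun z hz => ?_, rfl⟩⟩
    obtain rfl := (Y.lev_eq_zero y z).1 (Nat.le_zero.1 hz)
    have h' : c x = c' y := h
    exact h' ▸ he x
  | succ l ih =>
    obtain ⟨t₁, ht₁⟩ := ih
    refine ⟨max t₁ (t' * Nat.card (BallType D t' l) + 1), fun t ht X Y c c' x y h e he => ?_⟩
    have ht₁' : t₁ ≤ t := (le_max_left _ _).trans ht
    have hcard : t' * Nat.card (BallType D t' l) < t := (le_max_right _ _).trans ht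
    have : Nonempty X.V := ⟨x⟩
    have : Nonempty Y.V := ⟨y⟩
    have := BallType.finite D t' l
    have := BallType.finite C t l
    obtain ⟨ρ, hρ, hρ'⟩ := X.exists_rep l
    obtain ⟨π, hπ, hπ'⟩ := Y.exists_rep l
    rw [ballType_succ_eq_iff X Y c c' t l hρ hρ' hπ hπ'] at h
    choose g hg using fun τ => (h τ).exists_coloring hcard (X.ballType e t' l)
    -- the refined type that the ball around a representative should receive
    let G : Y.V → BallType D t' l := fun z => g (Y.ballType c' t l z) z
    have hex : ∀ z, ∃ e₁ : Y.V → D, π z = z → Y.lev y z ≤ l + 1 →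
        (∀ u, Y.lev z u ≤ l → R (c' u) (e₁ u)) ∧ Y.ballType e₁ t' l z = G z := by
      intro z
      by_cases hz : π z = z ∧ Y.lev y z ≤ l + 1
      · have h1 := (hg (Y.ballType c' t l z) (G z) 1 ht').2 (by
          rw [Nat.cast_one, Set.one_le_encard_iff_nonempty]
          exact ⟨z, ⟨hz, rfl⟩, rfl⟩)
        rw [Nat.cast_one, Set.one_le_encard_iff_nonempty] at h1
        obtain ⟨w, ⟨-, hw⟩, hwG⟩ := h1
        obtain ⟨e₁, he₁, he₁'⟩ := ht₁ t ht₁' X Y c c' w z hw e he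
        exact ⟨e₁, fun _ _ => ⟨he₁, he₁'.symm.trans hwG⟩⟩
      · exact ⟨fun _ => e x, fun h1 h2 => absurd ⟨h1, h2⟩ hz⟩
    choose E hE using hex
    let e' : Y.V → D := fun u => E (π u) u
    have hπl : ∀ u, Y.lev (π u) u ≤ l := fun u => Y.lev_comm u (π u) ▸ hπ u
    have hππ : ∀ u, π (π u) = π u := fun u => hπ' _ _ (hπl u)
    have he' : ∀ z, π z = z → Y.lev y z ≤ l + 1 → Y.ballType e' t' l z = G z := by
      intro z hz hyz
      rw [← (hE z hz hyz).2]
      refine Y.ballType_congr t' l fun u hu => ?_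
      simp only [e', ← hπ' z u hu, hz]
    refine ⟨e', fun u hu => ?_, ?_⟩
    · exact (hE (π u) (hππ u) (Y.lev_le_of_le hu ((hπ u).trans (Nat.le_succ l)))).1 u (hπl u)
    · rw [ballType_succ_eq_iff X Y e e' t' l hρ hρ' hπ hπ']
      intro σ
      refine SameCardUpTo.of_fibers (X.ballType c t l) (Y.ballType c' t l) fun τ => ?_
      have hX : {z ∈ {z | (ρ z = z ∧ X.lev x z ≤ l + 1) ∧ X.ballType e t' l z = σ} |
            X.ballType c t l z = τ} =
          {z ∈ {z | (ρ z = z ∧ X.lev x z ≤ l + 1) ∧ X.ballType c t l z = τ} |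
            X.ballType e t' l z = σ} := by
        ext z
        exact and_right_comm
      have hY : {z ∈ {z | (π z = z ∧ Y.lev y z ≤ l + 1) ∧ Y.ballType e' t' l z = σ} |
            Y.ballType c' t l z = τ} =
          {z ∈ {z | (π z = z ∧ Y.lev y z ≤ l + 1) ∧ Y.ballType c' t l z = τ} | g τ z = σ} := by
        ext z
        constructor
        · rintro ⟨⟨hz, hz'⟩, rfl⟩
          exact ⟨⟨hz, rfl⟩, (he' z hz.1 hz.2).symm.trans hz'⟩
        · rintro ⟨⟨hz, rfl⟩, hz'⟩
          exact ⟨⟨hz, (he' z hz.1 hz.2).trans hz'⟩, rfl⟩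
      rw [hX, hY]
      exact hg τ σ

lemma exists_pair {t : ℕ} (ht : 2 ≤ t) (X Y : LevelSpace d) (c : X.V → C) (c' : Y.V → C) (l : ℕ)
    {x : X.V} {y : Y.V} (h : X.ballType c t l x = Y.ballType c' t l y) {u v : X.V}
    (hu : X.lev x u ≤ l) (hv : X.lev x v ≤ l) :
    ∃ u' v' : Y.V, Y.lev y u' ≤ l ∧ Y.lev y v' ≤ l ∧ c' u' = c u ∧ c' v' = c v ∧
      Y.lev u' v' = X.lev u v := by
  induction l generalizing x y u v with
  | zero =>
    obtain rfl := (X.lev_eq_zero x u).1 (Nat.le_zero.1 hu)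
    obtain rfl := (X.lev_eq_zero x v).1 (Nat.le_zero.1 hv)
    exact ⟨y, y, (Y.lev_self y).le, (Y.lev_self y).le, h.symm, h.symm, by simp [lev_self]⟩
  | succ l ih =>
    have packing : ∀ {k : ℕ} (hk : k ≤ t) (τ : BallType C t l) (f : Fin k → X.V),
        X.IsPacking l x f → (∀ i, X.ballType c t l (f i) = τ) →
        ∃ f' : Fin k → Y.V, Y.IsPacking l y f' ∧ ∀ i, Y.ballType c' t l (f' i) = τ :=
      fun {k} hk τ f hf hτ => (Set.ext_iff.1 h (τ, ⟨k, by omega⟩)).1 ⟨f, hf, hτ⟩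
    have single : ∀ w, X.lev x w ≤ l + 1 → ∃ w', Y.lev y w' ≤ l + 1 ∧
        X.ballType c t l w = Y.ballType c' t l w' := by
      intro w hw
      obtain ⟨f', hf', hτ⟩ := packing (k := 1) (by omega) (X.ballType c t l w) (fun _ => w)
        ⟨fun _ => hw, fun i j hij => absurd (Subsingleton.elim i j) hij⟩ fun _ => rfl
      exact ⟨f' 0, hf'.1 0, (hτ 0).symm⟩
    rcases le_or_gt (X.lev u v) l with huv | huv
    · obtain ⟨w, hw, hτ⟩ := single u hu
      obtain ⟨u', v', hu', hv', h1⟩ := ih (u := u) hτ ((X.lev_self u).le.trans l.zero_le) huv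
      exact ⟨u', v', Y.lev_le_of_le hw (hu'.trans (Nat.le_succ l)),
        Y.lev_le_of_le hw (hv'.trans (Nat.le_succ l)), h1⟩
    · have hsep : ∃ u₁ v₁, Y.lev y u₁ ≤ l + 1 ∧ Y.lev y v₁ ≤ l + 1 ∧ l < Y.lev u₁ v₁ ∧
          X.ballType c t l u = Y.ballType c' t l u₁ ∧ X.ballType c t l v = Y.ballType c' t l v₁ := by
        by_cases hτ : X.ballType c t l u = X.ballType c t l v
        · obtain ⟨f', hf', hf'τ⟩ := packing (k := 2) ht (X.ballType c t l u) ![u, v]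
            ⟨by simp [Fin.forall_fin_two, hu, hv],
              by simp [Fin.forall_fin_two, huv, X.lev_comm v u]⟩
            (by simp [Fin.forall_fin_two, hτ])
          exact ⟨f' 0, f' 1, hf'.1 0, hf'.1 1, hf'.2 0 1 (by simp), (hf'τ 0).symm,
            hτ.symm.trans (hf'τ 1).symm⟩
        · obtain ⟨u₁, hu₁, h1⟩ := single u hu
          obtain ⟨v₁, hv₁, h2⟩ := single v hv
          refine ⟨u₁, v₁, hu₁, hv₁, ?_, h1, h2⟩
          by_contra hlt
          exact hτ (h1.trans ((Y.ballType_eq_of_lev_le c' t l (not_lt.1 hlt)).trans h2.symm))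
      obtain ⟨u₁, v₁, hu₁, hv₁, hlt, h1, h2⟩ := hsep
      obtain ⟨u', -, hu', -, hcu, -⟩ := ih h1 ((X.lev_self u).le.trans l.zero_le)
        ((X.lev_self u).le.trans l.zero_le)
      obtain ⟨v', -, hv', -, hcv, -⟩ := ih h2 ((X.lev_self v).le.trans l.zero_le)
        ((X.lev_self v).le.trans l.zero_le)
      have hyu := Y.lev_le_of_le hu₁ (hu'.trans (Nat.le_succ l))
      have hyv := Y.lev_le_of_le hv₁ (hv'.trans (Nat.le_succ l))
      refine ⟨u', v', hyu, hyv, hcu, hcv, ?_⟩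
      have h3 : X.lev u v ≤ l + 1 := X.lev_le_of_le (X.lev_comm x u ▸ hu) hv
      have h4 : Y.lev u' v' ≤ l + 1 := Y.lev_le_of_le (Y.lev_comm y u' ▸ hyu) hyv
      have h5 : ¬ Y.lev u' v' ≤ l := fun h5 => not_lt.2
        (Y.lev_le_of_le (Y.lev_le_of_le hu' h5) (Y.lev_comm v₁ v' ▸ hv')) hlt
      omega

end LevelSpace

namespace LevelSpace

variable {d : ℕ} {C : Type} {ι : Type u}

/-- The structure on a coloured level space in which adjacency of distinct points is determined by
their colours and their distance, and the unary predicates by the colours. -/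
def toStr (X : LevelSpace d) (c : X.V → C) (A : C → C → ℕ → Prop) (L : C → ι → Prop) : MStr ι :=
  ⟨X.V, fun u v => u ≠ v ∧ A (c u) (c v) (X.lev u v), fun a u => L (c u) a⟩

/-- Extend a colouring by the values of the first-order variables in `F` and the set variables
in `F'`. -/
def extColor (X : LevelSpace d) (c : X.V → C) (F F' : Finset ℕ) (v : ℕ → X.V) (s : ℕ → Set X.V) :
    X.V → C × (F → Prop) × (F' → Prop) :=
  fun x => (c x, fun i => v i = x, fun Z => x ∈ s Z)

lemma extColor_pair {t : ℕ} (ht : 2 ≤ t) {X Y : LevelSpace d} {c : X.V → C} {c' : Y.V → C}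
    {F F' : Finset ℕ} {v : ℕ → X.V} {w : ℕ → Y.V} {s : ℕ → Set X.V} {s' : ℕ → Set Y.V}
    {x : X.V} {y : Y.V} (h : X.ballType (X.extColor c F F' v s) t d x =
      Y.ballType (Y.extColor c' F F' w s') t d y) {i j : ℕ} (hi : i ∈ F) (hj : j ∈ F) :
    Y.lev (w i) (w j) = X.lev (v i) (v j) ∧
      Y.extColor c' F F' w s' (w i) = X.extColor c F F' v s (v i) := by
  obtain ⟨a, b, -, -, ha, hb, hab⟩ :=
    exists_pair ht X Y _ _ d h (X.lev_le x (v i)) (X.lev_le x (v j))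
  have h1 : w i = a := (congrFun (congrArg (·.2.1) ha) ⟨i, hi⟩).mpr rfl
  have h2 : w j = b := (congrFun (congrArg (·.2.1) hb) ⟨j, hj⟩).mpr rfl
  rw [h1, h2]
  exact ⟨hab, ha⟩

lemma realize_of_ballType_eq [Finite C] (A : C → C → ℕ → Prop) (L : C → ι → Prop) (φ : MSOForm ι)
    (F F' : Finset ℕ) (hF : φ.freeFO ⊆ F) (hF' : φ.freeSO ⊆ F') :
    ∃ t₀, ∀ t, t₀ ≤ t → ∀ (X Y : LevelSpace d) (c : X.V → C) (c' : Y.V → C) (v : ℕ → X.V)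
      (w : ℕ → Y.V) (s : ℕ → Set X.V) (s' : ℕ → Set Y.V) (x : X.V) (y : Y.V),
      X.ballType (X.extColor c F F' v s) t d x = Y.ballType (Y.extColor c' F F' w s') t d y →
      (X.toStr c A L).Realize φ v s → (Y.toStr c' A L).Realize φ w s' := by
  induction φ generalizing F F' with
  | fal => exact ⟨0, fun _ _ _ _ _ _ _ _ _ _ _ _ _ h => h⟩
  | eq i j =>
    have hi : i ∈ F := hF (by simp [MSOForm.freeFO])
    have hj : j ∈ F := hF (by simp [MSOForm.freeFO])
    refine ⟨2, fun t ht X Y c c' v w s s' x y h hv => ?_⟩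
    have hv' : v i = v j := hv
    have := (extColor_pair ht h hi hj).1
    rw [hv', X.lev_self] at this
    exact (Y.lev_eq_zero _ _).1 this
  | edge i j =>
    have hi : i ∈ F := hF (by simp [MSOForm.freeFO])
    have hj : j ∈ F := hF (by simp [MSOForm.freeFO])
    refine ⟨2, fun t ht X Y c c' v w s s' x y h hv => ?_⟩
    obtain ⟨hne, hA⟩ : v i ≠ v j ∧ A (c (v i)) (c (v j)) (X.lev (v i) (v j)) := hv
    obtain ⟨h1, h2⟩ := extColor_pair ht h hi hj
    have h3 := (extColor_pair ht h hj hi).2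
    have h4 : c' (w i) = c (v i) := congrArg Prod.fst h2
    have h5 : c' (w j) = c (v j) := congrArg Prod.fst h3
    refine (show w i ≠ w j ∧ A (c' (w i)) (c' (w j)) (Y.lev (w i) (w j)) from ⟨?_, ?_⟩)
    · intro hw
      rw [hw, Y.lev_self] at h1
      exact hne ((X.lev_eq_zero _ _).1 h1.symm)
    · rw [h1, h4, h5]
      exact hA
  | pred a i =>
    have hi : i ∈ F := hF (by simp [MSOForm.freeFO])
    refine ⟨2, fun t ht X Y c c' v w s s' x y h hv => ?_⟩
    have h2 : c' (w i) = c (v i) := congrArg Prod.fst (extColor_pair ht h hi hi).2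
    exact (show L (c' (w i)) a from h2 ▸ hv)
  | mem i Z =>
    have hi : i ∈ F := hF (by simp [MSOForm.freeFO])
    have hZ : Z ∈ F' := hF' (by simp [MSOForm.freeSO])
    refine ⟨2, fun t ht X Y c c' v w s s' x y h hv => ?_⟩
    have h2 := (extColor_pair ht h hi hi).2
    exact (congrFun (congrArg (·.2.2) h2) ⟨Z, hZ⟩).mpr hv
  | imp φ ψ ih₁ ih₂ =>
    obtain ⟨t₁, h₁⟩ := ih₁ F F' (Finset.union_subset_left hF) (Finset.union_subset_left hF')
    obtain ⟨t₂, h₂⟩ := ih₂ F F' (Finset.union_subset_right hF) (Finset.union_subset_right hF')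
    refine ⟨max t₁ t₂, fun t ht X Y c c' v w s s' x y h hv hw => ?_⟩
    exact h₂ t ((le_max_right _ _).trans ht) X Y c c' v w s s' x y h
      (hv (h₁ t ((le_max_left _ _).trans ht) Y X c' c w v s' s y x h.symm hw))
  | exFO n φ ih =>
    have hF₁ : φ.freeFO ⊆ insert n F := Finset.subset_insert_iff.2 hF
    obtain ⟨t₁, h₁⟩ := ih (insert n F) F' hF₁ hF'
    let R : C × (F → Prop) × (F' → Prop) →
        C × (↥(insert n F) → Prop) × (F' → Prop) → Prop := fun a b =>
      b.1 = a.1 ∧ b.2.2 = a.2.2 ∧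
        ∀ i (hi : i ∈ F), i ≠ n → (b.2.1 ⟨i, Finset.mem_insert_of_mem hi⟩ ↔ a.2.1 ⟨i, hi⟩)
    obtain ⟨t₀, h₀⟩ := exists_refinement (d := d) R (t' := max t₁ 2) (by omega) d
    refine ⟨t₀, fun t ht X Y c c' v w s s' x y h => ?_⟩
    rintro ⟨z, hz⟩
    change X.V at z
    obtain ⟨e', he', hty⟩ := h₀ t ht X Y _ _ x y h
      (X.extColor c (insert n F) F' (Function.update v n z) s)
      (fun a => ⟨rfl, rfl, fun i _ hin => by simp [extColor, hin]⟩)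
    have hR := fun a => he' a (Y.lev_le y a)
    obtain ⟨z', -, -, -, hz', -, -⟩ :=
      exists_pair (le_max_right _ _) X Y _ _ d hty (X.lev_le x z) (X.lev_le x z)
    have hflag : ∀ a, (e' a).2.1 ⟨n, Finset.mem_insert_self n F⟩ ↔ z' = a := by
      have hz₁ : (e' z').2.1 ⟨n, Finset.mem_insert_self n F⟩ := by
        rw [hz']; simp [extColor]
      intro a
      refine ⟨fun ha => ?_, fun ha => ha ▸ hz₁⟩
      obtain ⟨b, b', -, -, hb, hb', hbb⟩ :=
        exists_pair (le_max_right _ _) Y X _ _ d hty.symm (Y.lev_le y z') (Y.lev_le y a)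
      rw [← hb] at hz₁
      rw [← hb'] at ha
      have h1 : z = b := by simpa [extColor] using hz₁
      have h2 : z = b' := by simpa [extColor] using ha
      rw [← h1, ← h2, X.lev_self] at hbb
      exact (Y.lev_eq_zero _ _).1 hbb.symm
    have hext : e' = Y.extColor c' (insert n F) F' (Function.update w n z') s' := by
      funext a
      obtain ⟨r1, r2, r3⟩ := hR a
      refine Prod.ext r1 (Prod.ext (funext fun i => propext ?_) r2)
      obtain ⟨i, hi⟩ := i
      rcases eq_or_ne i n with rfl | hin
      · simpa [extColor] using hflag a
      · have := r3 i (Finset.mem_of_mem_insert_of_ne hi hin) hin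
        simpa [extColor, hin] using this
    rw [hext] at hty
    exact ⟨z', h₁ _ (le_max_left _ _) X Y c c' _ _ s s' x y hty hz⟩
  | exSO Z φ ih =>
    have hF₁ : φ.freeSO ⊆ insert Z F' := Finset.subset_insert_iff.2 hF'
    obtain ⟨t₁, h₁⟩ := ih F (insert Z F') hF hF₁
    let R : C × (F → Prop) × (F' → Prop) →
        C × (F → Prop) × (↥(insert Z F') → Prop) → Prop := fun a b =>
      b.1 = a.1 ∧ b.2.1 = a.2.1 ∧
        ∀ i (hi : i ∈ F'), i ≠ Z → (b.2.2 ⟨i, Finset.mem_insert_of_mem hi⟩ ↔ a.2.2 ⟨i, hi⟩)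
    obtain ⟨t₀, h₀⟩ := exists_refinement (d := d) R (t' := max t₁ 1) (by omega) d
    refine ⟨t₀, fun t ht X Y c c' v w s s' x y h => ?_⟩
    rintro ⟨B, hB⟩
    change Set X.V at B
    obtain ⟨e', he', hty⟩ := h₀ t ht X Y _ _ x y h
      (X.extColor c F (insert Z F') v (Function.update s Z B))
      (fun a => ⟨rfl, rfl, fun i _ hin => by simp [extColor, hin]⟩)
    have hR := fun a => he' a (Y.lev_le y a)
    let B' : Set Y.V := {a | (e' a).2.2 ⟨Z, Finset.mem_insert_self Z F'⟩}
    have hext : e' = Y.extColor c' F (insert Z F') w (Function.update s' Z B') := by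
      funext a
      obtain ⟨r1, r2, r3⟩ := hR a
      refine Prod.ext r1 (Prod.ext r2 (funext fun i => propext ?_))
      obtain ⟨i, hi⟩ := i
      rcases eq_or_ne i Z with rfl | hin
      · simp [extColor, B']
      · have := r3 i (Finset.mem_of_mem_insert_of_ne hi hin) hin
        simpa [extColor, hin] using this
    rw [hext] at hty
    exact ⟨B', h₁ _ (le_max_left _ _) X Y c c' v w _ _ x y hty hB⟩

/-- The truth of a sentence in a coloured level space depends only on the type of the whole space,
for a large enough counting threshold. -/
lemma exists_sat_iff_of_ballType_eq [Finite C] (A : C → C → ℕ → Prop) (L : C → ι → Prop)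
    (φ : MSOForm ι) (hφ : φ.IsSentence) :
    ∃ t, 0 < t ∧ ∀ (X Y : LevelSpace d) (c : X.V → C) (c' : Y.V → C) (x : X.V) (y : Y.V),
      X.ballType c t d x = Y.ballType c' t d y →
      ((X.toStr c A L).Sat φ ↔ (Y.toStr c' A L).Sat φ) := by
  obtain ⟨t₁, h₁⟩ := realize_of_ballType_eq (d := d) A L φ ∅ ∅ hφ.1.subset hφ.2.subset
  obtain ⟨t₀, h₀⟩ := exists_refinement (d := d) (C := C)
    (D := C × (↥(∅ : Finset ℕ) → Prop) × (↥(∅ : Finset ℕ) → Prop))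
    (fun a b => b.1 = a) (t' := max t₁ 1) (by omega) d
  have key : ∀ (X Y : LevelSpace d) (c : X.V → C) (c' : Y.V → C) (x : X.V) (y : Y.V),
      X.ballType c (max t₀ 1) d x = Y.ballType c' (max t₀ 1) d y →
      (X.toStr c A L).Sat φ → (Y.toStr c' A L).Sat φ := by
    intro X Y c c' x y h hX w s'
    obtain ⟨e', he', hty⟩ := h₀ _ (le_max_left _ _) X Y c c' x y h
      (X.extColor c ∅ ∅ (fun _ => x) (fun _ => ∅)) fun _ => rfl
    have hext : e' = Y.extColor c' ∅ ∅ w s' := by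
      funext a
      exact Prod.ext (he' a (Y.lev_le y a)) (Subsingleton.elim _ _)
    rw [hext] at hty
    exact h₁ _ (le_max_left _ _) X Y c c' _ w _ s' x y hty (hX _ _)
  exact ⟨max t₀ 1, by omega, fun X Y c c' x y h => ⟨key X Y c c' x y h, key Y X c' c y x h.symm⟩⟩

end LevelSpace

lemma Ultrafilter.exists_eventually_eq {α S : Type*} [Finite S] (U : Ultrafilter α) (f : α → S) :
    ∃ s, ∀ᶠ q in (U : Filter α), f q = s := by
  exact U.eventually_exists_iff.1 (.of_forall fun q => ⟨f q, rfl⟩)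

namespace LevelSpace

variable {d : ℕ} {C : Type}

/-- Indices of the functions that pick the members of packings. -/
abbrev PackingIndex (C : Type) (t : ℕ) : Type :=
  Σ l : ℕ, BallType C t l × Σ k : Fin (t + 1), Fin k

open Classical in
/-- A member of a packing around `x`, if there is one of the size and type given by the index. -/
noncomputable def pick (X : LevelSpace d) (c : X.V → C) (t : ℕ) (o : PackingIndex C t) (x : X.V) :
    X.V :=
  if h : ∃ f : Fin o.2.2.1 → X.V, X.IsPacking o.1 x f ∧ ∀ i, X.ballType c t o.1 (f i) = o.2.1
  then h.choose o.2.2.2 else x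

lemma exists_eventually_lev (U : Ultrafilter ℕ) (T : ℕ → LevelSpace d) (a b : ∀ q, (T q).V) :
    ∃ k, ∀ᶠ q in (U : Filter ℕ), (T q).lev (a q) (b q) = k := by
  obtain ⟨k, hk⟩ := U.exists_eventually_eq
    fun q => (⟨(T q).lev (a q) (b q), Nat.lt_succ_of_le ((T q).lev_le _ _)⟩ : Fin (d + 1))
  exact ⟨k, hk.mono fun q hq => congrArg Fin.val hq⟩

variable (U : Ultrafilter ℕ) (T : ℕ → LevelSpace d) (c : ∀ q, (T q).V → C)
  (a : ∀ q, ℕ → (T q).V) (H : Set ℕ)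

/-- The limit along an ultrafilter of countable subspaces enumerated by `a`; the set `H` of indices
contains at most one index for each point of the limit. -/
noncomputable def limit
    (hH : ∀ i ∈ H, ∀ j ∈ H, (∀ᶠ q in (U : Filter ℕ), a q i = a q j) → i = j) : LevelSpace d where
  V := H
  lev i j := (exists_eventually_lev U T (fun q => a q i) (fun q => a q j)).choose
  lev_le i j := by
    obtain ⟨q, hq⟩ :=
      (exists_eventually_lev U T (fun q => a q i) (fun q => a q j)).choose_spec.exists
    exact hq ▸ (T q).lev_le _ _
  lev_eq_zero i j := by
    have h := (exists_eventually_lev U T (fun q => a q i) (fun q => a q j)).choose_spec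
    constructor
    · intro h0
      rw [h0] at h
      exact Subtype.ext (hH i i.2 j j.2 (h.mono fun q hq => ((T q).lev_eq_zero _ _).1 hq))
    · rintro rfl
      obtain ⟨q, hq⟩ := h.exists
      exact hq ▸ (T q).lev_self _
  lev_comm i j := by
    obtain ⟨q, h1, h2⟩ :=
      ((exists_eventually_lev U T (fun q => a q i) (fun q => a q j)).choose_spec.and
        (exists_eventually_lev U T (fun q => a q j) (fun q => a q i)).choose_spec).exists
    exact h1 ▸ h2 ▸ (T q).lev_comm _ _
  lev_tri i j k := by
    obtain ⟨q, h1, h2, h3⟩ :=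
      ((exists_eventually_lev U T (fun q => a q i) (fun q => a q k)).choose_spec.and
        ((exists_eventually_lev U T (fun q => a q i) (fun q => a q j)).choose_spec.and
        (exists_eventually_lev U T (fun q => a q j) (fun q => a q k)).choose_spec)).exists
    exact h1 ▸ h2 ▸ h3 ▸ (T q).lev_tri _ _ _

/-- The colouring of the limit. -/
noncomputable def limitColor [Finite C] (i : H) : C :=
  (U.exists_eventually_eq fun q => c q (a q i)).choose

variable {U T c a H}

lemma eventually_limitColor [Finite C] (i : H) :
    ∀ᶠ q in (U : Filter ℕ), c q (a q i) = limitColor U T c a H i :=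
  (U.exists_eventually_eq fun q => c q (a q i)).choose_spec

lemma eventually_eq_iff
    (hH : ∀ i ∈ H, ∀ j ∈ H, (∀ᶠ q in (U : Filter ℕ), a q i = a q j) → i = j) (i j : H) :
    ∀ᶠ q in (U : Filter ℕ), (a q i = a q j ↔ i = j) := by
  by_cases hij : i = j
  · subst hij
    exact .of_forall fun q => by simp
  · have : ∀ᶠ q in (U : Filter ℕ), ¬ a q i = a q j :=
      Ultrafilter.eventually_not.2 fun h => hij (Subtype.ext (hH i i.2 j j.2 h))
    exact this.mono fun q hq => by simp [hij, hq]

variable (hH : ∀ i ∈ H, ∀ j ∈ H, (∀ᶠ q in (U : Filter ℕ), a q i = a q j) → i = j)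

lemma eventually_limit_lev (i j : H) :
    ∀ᶠ q in (U : Filter ℕ), (T q).lev (a q i) (a q j) = (limit U T a H hH).lev i j :=
  (exists_eventually_lev U T (fun q => a q i) (fun q => a q j)).choose_spec

lemma eventually_limit_ballType [Finite C] (t : ℕ)
    (hrep : ∀ m, ∃ h ∈ H, ∀ᶠ q in (U : Filter ℕ), a q h = a q m)
    (hpick : ∀ i o, ∃ m, ∀ᶠ q in (U : Filter ℕ), a q m = (T q).pick (c q) t o (a q i))
    (l : ℕ) (i : H) : ∀ᶠ q in (U : Filter ℕ), (T q).ballType (c q) t l (a q i) =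
      (limit U T a H hH).ballType (limitColor U T c a H) t l i := by
  induction l generalizing i with
  | zero =>
    exact (eventually_limitColor (c := c) i :
      ∀ᶠ q in (U : Filter ℕ), c q (a q i) = limitColor U T c a H i)
  | succ l ih =>
    have := BallType.finite C t l
    have packing_iff : ∀ (k : ℕ) (f : Fin k → H) (τ : BallType C t l),
        ∀ᶠ q in (U : Filter ℕ), (((T q).IsPacking l (a q i) (fun j => a q (f j)) ∧
          ∀ j, (T q).ballType (c q) t l (a q (f j)) = τ) ↔
          ((limit U T a H hH).IsPacking l i f ∧
          ∀ j, (limit U T a H hH).ballType (limitColor U T c a H) t l (f j) = τ)) := by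
      intro k f τ
      filter_upwards [Filter.eventually_all.2 fun j => eventually_limit_lev hH i (f j),
        Filter.eventually_all.2 fun j => Filter.eventually_all.2 fun j' =>
          eventually_limit_lev hH (f j) (f j'),
        Filter.eventually_all.2 fun j => ih (f j)] with q h1 h2 h3
      simp only [IsPacking, h1, h2, h3]
    have mem_iff : ∀ p : BallType C t l × Fin (t + 1), ∀ᶠ q in (U : Filter ℕ),
        ((∃ f : Fin p.2 → (T q).V, (T q).IsPacking l (a q i) f ∧
          ∀ j, (T q).ballType (c q) t l (f j) = p.1) ↔
        (∃ f : Fin p.2 → H, (limit U T a H hH).IsPacking l i f ∧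
          ∀ j, (limit U T a H hH).ballType (limitColor U T c a H) t l (f j) = p.1)) := by
      intro p
      by_cases hp : ∃ f : Fin p.2 → H, (limit U T a H hH).IsPacking l i f ∧
          ∀ j, (limit U T a H hH).ballType (limitColor U T c a H) t l (f j) = p.1
      · obtain ⟨f, hf⟩ := hp
        filter_upwards [packing_iff p.2 f p.1] with q hq
        exact ⟨fun _ => ⟨f, hf⟩, fun _ => ⟨_, hq.2 hf⟩⟩
      · have : ∀ᶠ q in (U : Filter ℕ), ¬ ∃ f : Fin p.2 → (T q).V, (T q).IsPacking l (a q i) f ∧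
            ∀ j, (T q).ballType (c q) t l (f j) = p.1 := by
          rw [Ultrafilter.eventually_not]
          intro hex
          choose m hm using fun j : Fin p.2 => hpick i ⟨l, p.1, p.2, j⟩
          choose r hrH hr using fun j => hrep (m j)
          let f : Fin p.2 → H := fun j => ⟨r j, hrH j⟩
          obtain ⟨q, h1, h2, h3, h4⟩ := (hex.and ((packing_iff p.2 f p.1).and
            ((Filter.eventually_all.2 hm).and (Filter.eventually_all.2 hr)))).exists
          refine hp ⟨f, h2.1 ?_⟩
          have hf : (fun j => a q (f j)) = h1.choose := by
            funext j
            have h5 : a q (f j) = a q (m j) := h4 j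
            rw [h5, h3 j, pick, dif_pos h1]
          have h6 := h1.choose_spec
          rw [← hf] at h6
          exact h6
        exact this.mono fun q hq => iff_of_false hq hp
    filter_upwards [Filter.eventually_all.2 mem_iff] with q hq
    exact Set.ext fun p => hq p

end LevelSpace

namespace LevelSpace

variable {d : ℕ} {C : Type} {ι : Type u}

instance [Finite C] (t : ℕ) : Countable (PackingIndex C t) :=
  have := BallType.finite C t
  inferInstance

/-- Any sentence is separated, on coloured level spaces, from its negation by a finite set of
first-order types. -/
lemma exists_foType_separation [Finite C] (A : C → C → ℕ → Prop) (L : C → ι → Prop)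
    (φ : MSOForm ι) (hφ : φ.IsSentence) :
    ∃ q, ∀ (X Y : LevelSpace d) (c : X.V → C) (c' : Y.V → C) (v : ℕ → X.V) (w : ℕ → Y.V),
      (X.toStr c A L).foType q 0 v = (Y.toStr c' A L).foType q 0 w →
      (X.toStr c A L).Sat φ → (Y.toStr c' A L).Sat φ := by
  by_contra! hcon
  choose X Y c c' v w hvw hX hY using hcon
  obtain ⟨t, ht, hsat⟩ := exists_sat_iff_of_ballType_eq (d := d) A L φ hφ
  let O := PackingIndex C t
  have : Nonempty O := ⟨⟨0, c 0 (v 0 0), ⟨1, by omega⟩, ⟨0, by simp⟩⟩⟩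
  obtain ⟨req, hreq⟩ := exists_requests (O ⊕ O)
  choose a b hab hplay using fun q => MStr.exists_play (M := (X q).toStr (c q) A L)
    (N := (Y q).toStr (c' q) A L) ((X q).pick (c q) t) ((Y q).pick (c' q) t) req q (hvw q)
  change ∀ q, ℕ → (X q).V at a
  change ∀ q, ℕ → (Y q).V at b
  let U : Ultrafilter ℕ := Filter.hyperfilter ℕ
  have hlt : ∀ m, ∀ᶠ q in (U : Filter ℕ), m < q := fun m =>
    Nat.hyperfilter_le_atTop (Filter.eventually_gt_atTop m)
  have heq : ∀ i j q, i < q → j < q → (a q i = a q j ↔ b q i = b q j) := fun i j q hi hj =>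
    iff_of_eq (congrFun (congrFun (congrArg Prod.fst (hab q)) ⟨i, hi⟩) ⟨j, hj⟩)
  have hE : ∀ i j q, i < q → j < q →
      ((a q i ≠ a q j ∧ A (c q (a q i)) (c q (a q j)) ((X q).lev (a q i) (a q j))) ↔
      (b q i ≠ b q j ∧ A (c' q (b q i)) (c' q (b q j)) ((Y q).lev (b q i) (b q j)))) :=
    fun i j q hi hj =>
      iff_of_eq (congrFun (congrFun (congrArg (fun x => x.2.1) (hab q)) ⟨i, hi⟩) ⟨j, hj⟩)
  have hP : ∀ e i q, i < q → (L (c q (a q i)) e ↔ L (c' q (b q i)) e) := fun e i q hi =>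
    iff_of_eq (congrFun (congrFun (congrArg (fun x => x.2.2) (hab q)) e) ⟨i, hi⟩)
  have heqU : ∀ i j, (∀ᶠ q in (U : Filter ℕ), a q i = a q j) ↔
      ∀ᶠ q in (U : Filter ℕ), b q i = b q j := fun i j =>
    Filter.eventually_congr (((hlt i).and (hlt j)).mono fun q hq => heq i j q hq.1 hq.2)
  let H : Set ℕ := {n | ∀ m < n, ¬ ∀ᶠ q in (U : Filter ℕ), a q m = a q n}
  have hH : ∀ i ∈ H, ∀ j ∈ H, (∀ᶠ q in (U : Filter ℕ), a q i = a q j) → i = j := by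
    intro i hi j hj hij
    rcases lt_trichotomy i j with h | h | h
    · exact absurd hij (hj i h)
    · exact h
    · exact absurd (hij.mono fun _ hq => hq.symm) (hi j h)
  have hrep : ∀ m, ∃ h ∈ H, ∀ᶠ q in (U : Filter ℕ), a q h = a q m := by
    intro m
    induction m using Nat.strong_induction_on with
    | _ m ih =>
      by_cases hm : m ∈ H
      · exact ⟨m, hm, .of_forall fun _ => rfl⟩
      · have hm' : ∃ k < m, ∀ᶠ q in (U : Filter ℕ), a q k = a q m := by
          by_contra hk
          exact hm fun k hkm h => hk ⟨k, hkm, h⟩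
        obtain ⟨k, hkm, hk⟩ := hm'
        obtain ⟨h, hh, hhk⟩ := ih k hkm
        exact ⟨h, hh, (hhk.and hk).mono fun q hq => hq.1.trans hq.2⟩
  have hpick : ∀ i o, ∃ m, ∀ᶠ q in (U : Filter ℕ), a q m = (X q).pick (c q) t o (a q i) := by
    intro i o
    obtain ⟨m, him, hm⟩ := hreq i (.inl o)
    exact ⟨m, (hlt m).mono fun q hq => (hplay q m hq i him o).1 hm⟩
  have hpick' : ∀ i o, ∃ m, ∀ᶠ q in (U : Filter ℕ), b q m = (Y q).pick (c' q) t o (b q i) := by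
    intro i o
    obtain ⟨m, him, hm⟩ := hreq i (.inr o)
    exact ⟨m, (hlt m).mono fun q hq => (hplay q m hq i him o).2 hm⟩
  have hH' : ∀ i ∈ H, ∀ j ∈ H, (∀ᶠ q in (U : Filter ℕ), b q i = b q j) → i = j :=
    fun i hi j hj h => hH i hi j hj ((heqU i j).2 h)
  have hrep' : ∀ m, ∃ h ∈ H, ∀ᶠ q in (U : Filter ℕ), b q h = b q m := fun m => by
    obtain ⟨h, hh, hm⟩ := hrep m
    exact ⟨h, hh, (heqU h m).1 hm⟩
  have hstr : (limit U X a H hH).toStr (limitColor U X c a H) A L =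
      (limit U Y b H hH').toStr (limitColor U Y c' b H) A L := by
    have h1 : ∀ i j : H, (i ≠ j ∧ A (limitColor U X c a H i) (limitColor U X c a H j)
        ((limit U X a H hH).lev i j)) ↔ (i ≠ j ∧ A (limitColor U Y c' b H i)
        (limitColor U Y c' b H j) ((limit U Y b H hH').lev i j)) := by
      intro i j
      obtain ⟨q, e1, e2, e3, e4, e5, e6, e7, e8, e9, e10⟩ := ((eventually_limitColor (c := c) i).and
        ((eventually_limitColor (c := c) j).and ((eventually_limitColor (c := c') i).and
        ((eventually_limitColor (c := c') j).and ((eventually_limit_lev hH i j).and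
        ((eventually_limit_lev hH' i j).and ((eventually_eq_iff hH i j).and
        ((eventually_eq_iff hH' i j).and ((hlt i).and (hlt j)))))))))).exists
      have := hE i j q e9 e10
      rwa [e1, e2, e3, e4, e5, e6, ne_eq, e7, ne_eq, e8] at this
    have h2 : ∀ e (i : H), L (limitColor U X c a H i) e ↔ L (limitColor U Y c' b H i) e := by
      intro e i
      obtain ⟨q, e1, e2, e3⟩ := ((eventually_limitColor (c := c) i).and
        ((eventually_limitColor (c := c') i).and (hlt i))).exists
      have := hP e i q e3
      rwa [e1, e2] at this
    exact congrArg₂ (fun E P => (⟨H, E, P⟩ : MStr ι))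
      (funext fun i => funext fun j => propext (h1 i j))
      (funext fun e => funext fun i => propext (h2 e i))
  obtain ⟨i, hi, -⟩ := hrep 0
  obtain ⟨q, e1, e2⟩ := ((eventually_limit_ballType hH t hrep hpick d ⟨i, hi⟩).and
    (eventually_limit_ballType hH' t hrep' hpick' d ⟨i, hi⟩)).exists
  have s1 := (hsat _ _ _ _ _ _ e1).1 (hX q)
  rw [hstr] at s1
  exact hY q ((hsat _ _ _ _ _ _ e2).2 s1)

/-- Every sentence is equivalent to a first-order one on coloured level spaces. -/
theorem exists_isFO [Finite C] [Finite ι] (A : C → C → ℕ → Prop) (L : C → ι → Prop)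
    (φ : MSOForm ι) (hφ : φ.IsSentence) :
    ∃ ψ : MSOForm ι, ψ.IsFO ∧ ψ.IsSentence ∧ ∀ (X : LevelSpace d) (c : X.V → C), Nonempty X.V →
      ((X.toStr c A L).Sat φ ↔ (X.toStr c A L).Sat ψ) := by
  obtain ⟨q, hq⟩ := exists_foType_separation (d := d) A L φ hφ
  let K : FOType ι q 0 → Prop := fun τ => ∃ (X : LevelSpace d) (c : X.V → C) (v : ℕ → X.V),
    (X.toStr c A L).Sat φ ∧ (X.toStr c A L).foType q 0 v = τ
  have := FOType.finite ι q 0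
  obtain ⟨ψ, h1, h2, h3, h4⟩ : MSOForm.FODef 0
      (fun (M : MStr ι) v => ∀ τ, M.foType q 0 v = τ → K τ) :=
    .all fun τ => (MStr.foDef_foType q 0 τ).imp (.const (K τ))
  refine ⟨ψ, h1, ⟨Finset.subset_empty.1 h2, h3⟩, fun X c ⟨x⟩ => ⟨fun h v s => ?_, fun h => ?_⟩⟩
  · exact (h4 _ v s).2 fun τ hτ => ⟨X, c, v, h, hτ⟩
  · obtain ⟨Y, c', w, hY, hw⟩ := (h4 _ _ _).1 (h (fun _ => x) fun _ => ∅) _ rfl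
    exact hq Y X c' c w _ hw hY

end LevelSpace

namespace SimpleGraph

variable {W : Type*} {g : SimpleGraph W}

/-- The parent function of a rooted tree. -/
lemma IsTree.exists_parent (hg : g.IsTree) (r : W) : ∃ par : W → W, par r = r ∧
    (∀ x, x ≠ r → g.Adj x (par x) ∧ g.dist r x = g.dist r (par x) + 1) ∧
    ∀ x y, g.Adj x y → g.dist r x = g.dist r y + 1 → par x = y := by
  classical
  have hex : ∀ x, x ≠ r → ∃ y, g.Adj x y ∧ g.dist r x = g.dist r y + 1 := by
    intro x hx
    obtain ⟨p, hp⟩ := hg.connected.exists_walk_length_eq_dist x r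
    cases p with
    | nil => exact absurd rfl hx
    | cons h p =>
      refine ⟨_, h, ?_⟩
      have h1 := dist_le p
      have h2 := hg.dist_eq_dist_add_one_of_adj r h
      rw [Walk.length_cons, dist_comm] at hp
      rw [dist_comm] at h1
      omega
  have huniq : ∀ x y y', g.Adj x y → g.dist r x = g.dist r y + 1 → g.Adj x y' →
      g.dist r x = g.dist r y' + 1 → y = y' := by
    intro x y y' h1 h2 h3 h4
    obtain ⟨p, hp⟩ := hg.connected.exists_walk_length_eq_dist y r
    obtain ⟨p', hp'⟩ := hg.connected.exists_walk_length_eq_dist y' r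
    have e1 := (Walk.cons h1 p).isPath_of_length_eq_dist
      (by rw [Walk.length_cons, hp, dist_comm, ← h2, dist_comm])
    have e2 := (Walk.cons h3 p').isPath_of_length_eq_dist
      (by rw [Walk.length_cons, hp', dist_comm, ← h4, dist_comm])
    have := congrArg Walk.snd ((hg.existsUnique_path x r).unique e1 e2)
    simpa using this
  choose! f hf using hex
  refine ⟨fun x => if x = r then r else f x, by simp, fun x hx => by simpa [hx] using hf x hx,
    fun x y hxy h => ?_⟩
  have hx : x ≠ r := by
    rintro rfl
    simp at h
  simpa [hx] using huniq x _ y (hf x hx).1 (hf x hx).2 hxy h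

variable {r : W} {par : W → W}

lemma dist_iterate_le (hg : g.Connected) (h0 : par r = r) (h : ∀ x, x ≠ r → g.Adj x (par x))
    (x : W) (k : ℕ) : g.dist x (par^[k] x) ≤ k := by
  induction k with
  | zero => simp
  | succ k ih =>
    rw [Function.iterate_succ_apply']
    rcases eq_or_ne (par^[k] x) r with hr | hr
    · rw [hr, h0, ← hr]
      omega
    · have h1 := hg.dist_triangle (u := x) (v := par^[k] x) (w := par (par^[k] x))
      rw [dist_eq_one_iff_adj.2 (h _ hr)] at h1
      omega

lemma exists_iterate_eq (hg : g.IsTree)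
    (h : ∀ x y, g.Adj x y → g.dist r x = g.dist r y + 1 → par x = y) {x y : W}
    (p : g.Walk x y) : ∃ i j, i + j ≤ p.length ∧ par^[i] x = par^[j] y ∧
      g.dist r x + j = g.dist r y + i ∧ j ≤ g.dist r y := by
  induction p with
  | nil => exact ⟨0, 0, by simp⟩
  | @cons x x' y hx p ih =>
    obtain ⟨i, j, hij, heq, hd, hj⟩ := ih
    rw [Walk.length_cons]
    rcases hg.dist_eq_dist_add_one_of_adj r hx with h1 | h1
    · refine ⟨i + 1, j, by omega, ?_, by omega, hj⟩
      rw [Function.iterate_succ_apply, h x x' hx h1, heq]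
    · have h2 := h x' x hx.symm h1
      cases i with
      | zero =>
        refine ⟨0, j + 1, by omega, ?_, by omega, by omega⟩
        rw [Function.iterate_succ_apply', ← heq]
        exact h2.symm
      | succ i =>
        refine ⟨i, j, by omega, ?_, by omega, hj⟩
        rw [← heq, Function.iterate_succ_apply, h2]

/-- The distance of two vertices on the same level of a rooted tree is twice the distance to their
lowest common ancestor. -/
lemma IsTree.exists_lev (hg : g.IsTree) (r : W) (d : ℕ) :
    ∃ lev : {w // g.dist r w = d} → {w // g.dist r w = d} → ℕ,
      (∀ x y, g.dist x.1 y.1 = 2 * lev x y) ∧ (∀ x y, lev x y ≤ d) ∧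
      ∀ x y z, lev x z ≤ max (lev x y) (lev y z) := by
  classical
  obtain ⟨par, h0, h1, h2⟩ := hg.exists_parent r
  have key : ∀ x y : {w // g.dist r w = d}, ∃ l ≤ d, par^[l] x.1 = par^[l] y.1 ∧
      2 * l ≤ g.dist x.1 y.1 := by
    intro x y
    obtain ⟨p, hp⟩ := hg.connected.exists_walk_length_eq_dist x.1 y.1
    obtain ⟨i, j, hij, heq, hd, hj⟩ := exists_iterate_eq hg h2 p
    rw [x.2, y.2] at hd
    obtain rfl : i = j := by omega
    exact ⟨i, by rw [y.2] at hj; omega, heq, by omega⟩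
  have hle : ∀ (x y : W) (l : ℕ), par^[l] x = par^[l] y → g.dist x y ≤ 2 * l := by
    intro x y l h
    have e1 := hg.connected.dist_triangle (u := x) (v := par^[l] x) (w := y)
    have e2 := dist_iterate_le hg.connected h0 (fun x hx => (h1 x hx).1) x l
    have e3 := dist_iterate_le hg.connected h0 (fun x hx => (h1 x hx).1) y l
    rw [dist_comm, ← h] at e3
    omega
  choose lev hd heq hlev using key
  refine ⟨lev, fun x y => (hle _ _ _ (heq x y)).antisymm (hlev x y), hd, fun x y z => ?_⟩
  have mono : ∀ (x y : W) (l m : ℕ), l ≤ m → par^[l] x = par^[l] y → par^[m] x = par^[m] y := by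
    intro x y l m hlm h
    obtain ⟨k, rfl⟩ := Nat.exists_eq_add_of_le' hlm
    rw [Function.iterate_add_apply, h, ← Function.iterate_add_apply]
  have e1 := mono _ _ _ _ (le_max_left (lev x y) (lev y z)) (heq x y)
  have e2 := mono _ _ _ _ (le_max_right (lev x y) (lev y z)) (heq y z)
  have := (hlev x z).trans (hle _ _ _ (e1.trans e2))
  omega

end SimpleGraph

namespace TModel

variable {r p d : ℕ} {G : PGraph p}

lemma nonempty (T : TModel r p d G) : Nonempty G.V := by
  have h : ∀ k ≤ d, ∃ w, T.g.dist T.root w = k := by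
    intro k
    induction k with
    | zero => exact fun _ => ⟨T.root, by simp⟩
    | succ k ih =>
      intro hk
      obtain ⟨w, hw⟩ := ih (by omega)
      obtain ⟨w', -, hw'⟩ := T.branch w (by omega)
      exact ⟨w', by omega⟩
  obtain ⟨w, hw⟩ := h d le_rfl
  exact ⟨T.leafEquiv.symm ⟨w, hw⟩⟩

/-- The colours used to present graphs with tree models as coloured level spaces: the two labels
of a leaf and the signature. -/
abbrev Color (r p d : ℕ) : Type := (Fin r × Fin p) × (Fin r → Fin r → Fin (d + 1) → Prop)

/-- The adjacency rule prescribed by the colours. -/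
def colorAdj (x y : Color r p d) (l : ℕ) : Prop := ∃ h : l < d + 1, x.2 x.1.1 y.1.1 ⟨l, h⟩

lemma exists_levelSpace (T : TModel r p d G) : ∃ (X : LevelSpace d) (c : X.V → Color r p d),
    Nonempty X.V ∧ X.toStr c colorAdj (fun x j => x.1.2 = j) = G.toStr := by
  obtain ⟨lev, hdist, hle, htri⟩ := T.tree.exists_lev T.root d
  let X : LevelSpace d :=
    { V := G.V
      lev := fun u v => lev (T.leafEquiv u) (T.leafEquiv v)
      lev_le := fun u v => hle _ _
      lev_eq_zero := fun u v => by
        have h := hdist (T.leafEquiv u) (T.leafEquiv v)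
        rw [← T.leafEquiv.apply_eq_iff_eq, Subtype.ext_iff,
          ← T.tree.connected.dist_eq_zero_iff, h]
        omega
      lev_comm := fun u v => by
        have h := hdist (T.leafEquiv u) (T.leafEquiv v)
        rw [SimpleGraph.dist_comm, hdist] at h
        omega
      lev_tri := fun u v w => htri _ _ _ }
  refine ⟨X, fun v => ((T.iLab v, G.label v), fun i j l => (i, j, (l : ℕ)) ∈ T.S), T.nonempty, ?_⟩
  have hE : ∀ u v : G.V, (u ≠ v ∧ ∃ _ : X.lev u v < d + 1, (T.iLab u, T.iLab v, X.lev u v) ∈ T.S) ↔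
      G.adj u v := by
    intro u v
    constructor
    · rintro ⟨huv, -, h⟩
      exact (T.edge_iff u v huv _ (hdist _ _)).2 h
    · intro h
      have huv : u ≠ v := by
        rintro rfl
        exact G.irrefl _ h
      exact ⟨huv, Nat.lt_succ_of_le (hle _ _), (T.edge_iff u v huv _ (hdist _ _)).1 h⟩
  exact congrArg (fun E => (⟨G.V, E, fun j v => G.label v = j⟩ : MStr (Fin p)))
    (funext fun u => funext fun v => propext (hE u v))

end TModel

/-- `MSO = FO` over `TM(r,p,d)`: every MSO sentence over the vocabulary of
`p`-labeled graphs is equivalent, over `TM(r,p,d)` (and hence over any subclass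
of it), to an FO sentence. -/
theorem stmt16 (r p d : ℕ) (φ : MSOForm (Fin p)) (hφ : φ.IsSentence) :
    ∃ ψ : MSOForm (Fin p), ψ.IsFO ∧ ψ.IsSentence ∧
      (∀ G ∈ TM r p d, (G.toStr.Sat φ ↔ G.toStr.Sat ψ)) ∧
      ∀ C : Set (PGraph p), C ⊆ TM r p d →
        ∀ G ∈ C, (G.toStr.Sat φ ↔ G.toStr.Sat ψ) := by
  obtain ⟨ψ, h1, h2, h3⟩ := LevelSpace.exists_isFO (d := d) (TModel.colorAdj (r := r) (p := p))
    (fun x j => x.1.2 = j) φ hφ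
  have h4 : ∀ G ∈ TM r p d, (G.toStr.Sat φ ↔ G.toStr.Sat ψ) := by
    rintro G ⟨T⟩
    obtain ⟨X, c, hX, hG⟩ := T.exists_levelSpace
    rw [← hG]
    exact h3 X c hX
  exact ⟨ψ, h1, h2, h4, fun C hC G hG => h4 G (hC hG)⟩
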